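/- All well behaved equilibria of the Length Game are Pareto efficient: if (S_1,...,S_n) is a well behaved profile in equilibrium with resulting allocation (A_1,...,A_n), then there is no allocation (B_1,...,B_n) (an n-tuple of pairwise disjoint measurable subsets of [0,1]) with u_i(B_i) ≥ u_i(A_i) for all i and u_j(B_j) > u_j(A_j) for some j. -/

import Mathlib

open MeasureTheory

/-- A piecewise uniform preference set: a finite union of closed intervals inside `[0,1]`
with positive total length. -/
def PWUniform (P : Set ℝ) : Prop :=
  (∃ (m : ℕ) (a b : Fin m → ℝ), P = ⋃ k, Set.Icc (a k) (b k)) ∧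
    P ⊆ Set.Icc 0 1 ∧ 0 < volume P

/-- Piecewise uniform utility: `u_P(X) = |X ∩ P| / |P|`. -/
noncomputable def pwUtil (P X : Set ℝ) : ℝ :=
  (volume (X ∩ P)).toReal / (volume P).toReal

/-- The Length Game precedence order: `i ≺ j` iff `|S i| < |S j|`, or `|S i| = |S j|`
and `i < j`. -/
def lgPrec {n : ℕ} (S : Fin n → Set ℝ) (i j : Fin n) : Prop :=
  volume (S i) < volume (S j) ∨ (volume (S i) = volume (S j) ∧ i < j)

/-- The Length Game allocation: `A i = S i \ ⋃_{j ≺ i} S j`. -/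
def lgAlloc {n : ℕ} (S : Fin n → Set ℝ) (i : Fin n) : Set ℝ :=
  S i \ ⋃ (j) (_ : lgPrec S j i), S j

/-- A valid Length Game strategy: a measurable subset of the cake `[0,1]`. -/
def IsStrategy (S : Set ℝ) : Prop :=
  MeasurableSet S ∧ S ⊆ Set.Icc 0 1

/-- A profile is in equilibrium if no agent can strictly increase their utility by
unilaterally switching to another strategy. -/
def lgEquilibrium {n : ℕ} (P S : Fin n → Set ℝ) : Prop :=
  ¬ ∃ (i : Fin n) (S' : Set ℝ), IsStrategy S' ∧
    pwUtil (P i) (lgAlloc S i) < pwUtil (P i) (lgAlloc (Function.update S i S') i)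

/-- Lebesgue measure restricted to subsets of a bounded measurable set takes all
intermediate values. -/
lemma exists_measurable_subset_volume_eq {T : Set ℝ} (hT : MeasurableSet T)
    (hsub : T ⊆ Set.Icc 0 1) {r : ENNReal} (hr : r ≤ volume T) :
    ∃ T' ⊆ T, MeasurableSet T' ∧ volume T' = r := by
  have hfin (X : Set ℝ) : volume (T ∩ X) ≠ ⊤ :=
    measure_ne_top_of_subset (Set.inter_subset_left.trans hsub) measure_Icc_lt_top.ne
  have hTfin : volume T ≠ ⊤ := by simpa using hfin Set.univ
  have hlip : LipschitzWith 1 fun x : ℝ => (volume (T ∩ Set.Iic x)).toReal := by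
    refine LipschitzWith.of_le_add fun x y => ?_
    have h : volume (T ∩ Set.Iic x) ≤ volume (T ∩ Set.Iic y) + ENNReal.ofReal (dist x y) := by
      calc volume (T ∩ Set.Iic x) ≤ volume ((T ∩ Set.Iic y) ∪ Set.Ioc y x) := by
            refine measure_mono fun z hz => ?_
            rcases le_or_gt z y with h | h
            · exact Or.inl ⟨hz.1, h⟩
            · exact Or.inr ⟨h, hz.2⟩
        _ ≤ volume (T ∩ Set.Iic y) + volume (Set.Ioc y x) := measure_union_le _ _
        _ ≤ _ := by
            rw [Real.volume_Ioc]
            gcongr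
            exact le_abs_self _
    have h' := ENNReal.toReal_mono (ENNReal.add_ne_top.2 ⟨hfin _, ENNReal.ofReal_ne_top⟩) h
    rwa [ENNReal.toReal_add (hfin _) ENNReal.ofReal_ne_top,
      ENNReal.toReal_ofReal dist_nonneg] at h'
  have h0 : volume (T ∩ Set.Iic 0) = 0 := by
    refine measure_mono_null (t := {0}) (fun z hz => ?_) (by simp)
    exact le_antisymm hz.2 (hsub hz.1).1
  have h1 : T ∩ Set.Iic 1 = T := Set.inter_eq_left.2 fun z hz => (hsub hz).2
  have hmem : r.toReal ∈ Set.Icc (volume (T ∩ Set.Iic 0)).toReal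
      (volume (T ∩ Set.Iic 1)).toReal := by
    rw [h0, h1]
    exact ⟨by simp, ENNReal.toReal_mono hTfin hr⟩
  obtain ⟨x, -, hx⟩ :=
    intermediate_value_Icc zero_le_one hlip.continuous.continuousOn hmem
  exact ⟨T ∩ Set.Iic x, Set.inter_subset_left, hT.inter measurableSet_Iic,
    (ENNReal.toReal_eq_toReal_iff' (hfin _) (ne_top_of_le_ne_top hTfin hr)).1 hx⟩

lemma PWUniform.measurableSet {P : Set ℝ} (hP : PWUniform P) : MeasurableSet P := by
  obtain ⟨⟨m, a, b, rfl⟩, -⟩ := hP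
  exact MeasurableSet.iUnion fun k => measurableSet_Icc

lemma PWUniform.volume_inter_ne_top {P : Set ℝ} (hP : PWUniform P) (X : Set ℝ) :
    volume (X ∩ P) ≠ ⊤ :=
  measure_ne_top_of_subset (Set.inter_subset_right.trans hP.2.1) measure_Icc_lt_top.ne

lemma PWUniform.volume_toReal_pos {P : Set ℝ} (hP : PWUniform P) : 0 < (volume P).toReal :=
  ENNReal.toReal_pos hP.2.2.ne' (by simpa using hP.volume_inter_ne_top Set.univ)

lemma pwUtil_lt_iff {P X Y : Set ℝ} (hP : PWUniform P) :
    pwUtil P X < pwUtil P Y ↔ volume (X ∩ P) < volume (Y ∩ P) := by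
  rw [pwUtil, pwUtil, div_lt_div_iff_of_pos_right hP.volume_toReal_pos,
    ENNReal.toReal_lt_toReal (hP.volume_inter_ne_top X) (hP.volume_inter_ne_top Y)]

lemma pwUtil_le_iff {P X Y : Set ℝ} (hP : PWUniform P) :
    pwUtil P X ≤ pwUtil P Y ↔ volume (X ∩ P) ≤ volume (Y ∩ P) := by
  rw [← not_lt, pwUtil_lt_iff hP, not_lt]

section LengthGame

variable {n : ℕ} {P S : Fin n → Set ℝ}

lemma lgPrec_irrefl (i : Fin n) : ¬ lgPrec S i i := by
  simp [lgPrec]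

lemma lgPrec.volume_le {i j : Fin n} (h : lgPrec S i j) : volume (S i) ≤ volume (S j) :=
  h.elim le_of_lt fun h => h.1.le

lemma lgAlloc_subset (i : Fin n) : lgAlloc S i ⊆ S i := Set.sdiff_subset

lemma measurableSet_lgAlloc (hS : ∀ i, IsStrategy (S i)) (i : Fin n) :
    MeasurableSet (lgAlloc S i) :=
  (hS i).1.diff (MeasurableSet.iUnion fun j => MeasurableSet.iUnion fun _ => (hS j).1)

lemma disjoint_lgAlloc_of_lgPrec {i j : Fin n} (h : lgPrec S i j) :
    Disjoint (lgAlloc S j) (S i) :=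
  Set.disjoint_left.2 fun _ hx hi => hx.2 (Set.mem_iUnion₂.2 ⟨i, h, hi⟩)

lemma iUnion_subset_iUnion_lgAlloc : ⋃ i, S i ⊆ ⋃ i, lgAlloc S i := by
  classical
  intro x hx
  obtain ⟨k, hk⟩ := Set.mem_iUnion.1 hx
  obtain ⟨i, hi, hmin⟩ := Finset.exists_min_image ({i | x ∈ S i} : Finset (Fin n))
    (fun i => toLex (volume (S i), i)) ⟨k, by simpa using hk⟩
  simp only [Finset.mem_filter, Finset.mem_univ, true_and] at hi hmin
  refine Set.mem_iUnion.2 ⟨i, hi, fun hx' => ?_⟩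
  obtain ⟨j, hji, hj⟩ := Set.mem_iUnion₂.1 hx'
  exact (hmin j hj).not_gt (Prod.Lex.toLex_lt_toLex.2 hji)

/-- The union of the other agents' strategies that are no longer than the piece agent `i`
receives. -/
def shorterUnion (S : Fin n → Set ℝ) (i : Fin n) : Set ℝ :=
  ⋃ (j) (_ : j ≠ i ∧ volume (S j) ≤ volume (lgAlloc S i)), S j

lemma measurableSet_shorterUnion (hS : ∀ i, IsStrategy (S i)) (i : Fin n) :
    MeasurableSet (shorterUnion S i) :=
  MeasurableSet.iUnion fun j => MeasurableSet.iUnion fun _ => (hS j).1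

/-- In equilibrium, the part of `P i` outside the shorter strategies of the others is no
longer than what agent `i` receives: otherwise `i` could claim slightly more of it
without being preceded by any further agent. -/
lemma lgEquilibrium.volume_diff_shorterUnion_le (heq : lgEquilibrium P S)
    (hP : ∀ i, PWUniform (P i)) (hS : ∀ i, IsStrategy (S i)) (i : Fin n) :
    volume (P i \ shorterUnion S i) ≤ volume (lgAlloc S i) := by
  by_contra! hlt
  obtain ⟨r, hr⟩ : ∃ r, volume (lgAlloc S i) < r ∧ r < volume (P i \ shorterUnion S i) ∧
      ∀ j, volume (lgAlloc S i) < volume (S j) → r < volume (S j) := by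
    have : (nhdsWithin (volume (lgAlloc S i)) (Set.Ioi (volume (lgAlloc S i)))).NeBot :=
      nhdsGT_neBot_of_exists_gt ⟨_, hlt⟩
    refine Filter.Eventually.exists
      (f := nhdsWithin (volume (lgAlloc S i)) (Set.Ioi (volume (lgAlloc S i)))) ?_
    refine Filter.Eventually.and self_mem_nhdsWithin (Filter.Eventually.and ?_ ?_)
    · exact mem_nhdsWithin_of_mem_nhds (Iio_mem_nhds hlt)
    · refine Filter.eventually_all.2 fun j => ?_
      by_cases h : volume (lgAlloc S i) < volume (S j)
      · filter_upwards [mem_nhdsWithin_of_mem_nhds (Iio_mem_nhds h)] with r hr _ using hr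
      · exact Filter.Eventually.of_forall fun _ h' => absurd h' h
  obtain ⟨hr, hrT, hrS⟩ := hr
  obtain ⟨T, hTsub, hTm, hT⟩ := exists_measurable_subset_volume_eq
    ((hP i).measurableSet.diff (measurableSet_shorterUnion hS i))
    (Set.sdiff_subset.trans (hP i).2.1) hrT.le
  refine heq ⟨i, T, ⟨hTm, (hTsub.trans Set.sdiff_subset).trans (hP i).2.1⟩, ?_⟩
  rw [pwUtil_lt_iff (hP i)]
  have hsub : T ⊆ lgAlloc (Function.update S i T) i ∩ P i := by
    refine fun x hx => ⟨⟨by simpa using hx, fun hx' => ?_⟩, (hTsub hx).1⟩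
    obtain ⟨j, hji, hj⟩ := Set.mem_iUnion₂.1 hx'
    have hne : j ≠ i := by
      rintro rfl
      exact lgPrec_irrefl _ hji
    have hle := hji.volume_le
    rw [Function.update_of_ne hne, Function.update_self, hT] at hle
    rw [Function.update_of_ne hne] at hj
    exact (hTsub hx).2 (Set.mem_iUnion₂.2
      ⟨j, ⟨hne, le_of_not_gt fun h => (hrS j h).not_ge hle⟩, hj⟩)
  calc volume (lgAlloc S i ∩ P i) ≤ volume (lgAlloc S i) := measure_mono Set.inter_subset_left
    _ < volume T := hT ▸ hr
    _ ≤ _ := measure_mono hsub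

/-- In a well behaved equilibrium, everything that some agent values is claimed, up to a
null set. -/
lemma lgEquilibrium.volume_diff_iUnion_eq_zero (heq : lgEquilibrium P S)
    (hP : ∀ i, PWUniform (P i)) (hS : ∀ i, IsStrategy (S i)) (hwb : ∀ i, S i ⊆ P i)
    (i : Fin n) : volume (P i \ ⋃ j, S j) = 0 := by
  have hfin (k : Fin n) : volume (lgAlloc S k) ≠ ⊤ :=
    measure_ne_top_of_subset ((lgAlloc_subset k).trans (hS k).2) measure_Icc_lt_top.ne
  have hbound (k : Fin n) (X : Set ℝ) (hX : MeasurableSet X) (hXP : X ⊆ P k)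
      (hdA : Disjoint (lgAlloc S k) X) (hdV : Disjoint (shorterUnion S k) X)
      (hdAV : volume (lgAlloc S k ∩ shorterUnion S k) = 0) : volume X = 0 := by
    have hle : volume (lgAlloc S k) + volume X ≤ volume (lgAlloc S k) + 0 :=
      calc volume (lgAlloc S k) + volume X
          = volume (lgAlloc S k \ shorterUnion S k) + volume X := by
            rw [measure_sdiff_null' hdAV]
        _ = volume ((lgAlloc S k \ shorterUnion S k) ∪ X) :=
            (measure_union (hdA.mono_left Set.sdiff_subset) hX).symm
        _ ≤ volume (P k \ shorterUnion S k) := by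
            refine measure_mono (Set.union_subset ?_ ?_)
            · exact Set.sdiff_subset_sdiff_left ((lgAlloc_subset k).trans (hwb k))
            · exact fun x hx => ⟨hXP hx, fun h => Set.disjoint_left.1 hdV h hx⟩
        _ ≤ volume (lgAlloc S k) + 0 := by
            simpa using heq.volume_diff_shorterUnion_le hP hS k
    exact nonpos_iff_eq_zero.1 ((ENNReal.add_le_add_iff_left (hfin k)).1 hle)
  have hU : MeasurableSet (⋃ j, S j) := MeasurableSet.iUnion fun j => (hS j).1
  refine hbound i _ ((hP i).measurableSet.diff hU) Set.sdiff_subset ?_ ?_ ?_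
  · exact Set.disjoint_sdiff_right.mono_left
      ((lgAlloc_subset i).trans (Set.subset_iUnion S i))
  · exact Set.disjoint_sdiff_right.mono_left
      (Set.iUnion₂_subset fun j _ => Set.subset_iUnion S j)
  rw [shorterUnion, Set.inter_iUnion₂]
  refine measure_iUnion_null fun k => measure_iUnion_null fun hk => ?_
  obtain ⟨hki, hk⟩ := hk
  by_cases hprec : lgPrec S k i
  · rw [(disjoint_lgAlloc_of_lgPrec hprec).inter_eq, measure_empty]
  have hAi : volume (lgAlloc S i) ≤ volume (S i) := measure_mono (lgAlloc_subset i)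
  have hSki : volume (S k) = volume (S i) :=
    (hk.trans hAi).antisymm (le_of_not_gt fun h => hprec (Or.inl h))
  have hik : lgPrec S i k := Or.inr
    ⟨hSki.symm, lt_of_le_of_ne (le_of_not_gt fun h => hprec (Or.inr ⟨hSki, h⟩)) hki.symm⟩
  by_contra hpos
  have hdA : Disjoint (lgAlloc S k) (lgAlloc S i ∩ S k) :=
    (disjoint_lgAlloc_of_lgPrec hik).mono_right
      (Set.inter_subset_left.trans (lgAlloc_subset i))
  have hlt : volume (lgAlloc S k) < volume (S k) := by
    calc volume (lgAlloc S k)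
        < volume (lgAlloc S k) + volume (lgAlloc S i ∩ S k) :=
          ENNReal.lt_add_right (hfin k) hpos
      _ = volume (lgAlloc S k ∪ (lgAlloc S i ∩ S k)) :=
          (measure_union hdA ((measurableSet_lgAlloc hS i).inter (hS k).1)).symm
      _ ≤ volume (S k) :=
          measure_mono (Set.union_subset (lgAlloc_subset k) Set.inter_subset_right)
  have hprecs {j : Fin n} (hj : volume (S j) ≤ volume (lgAlloc S k)) :
      lgPrec S j k ∧ lgPrec S j i :=
    ⟨Or.inl (hj.trans_lt hlt), Or.inl ((hj.trans_lt hlt).trans_eq hSki)⟩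
  refine hpos (hbound k _ ((measurableSet_lgAlloc hS i).inter (hS k).1)
    (Set.inter_subset_right.trans (hwb k)) hdA ?_ ?_)
  · refine Set.disjoint_iUnion₂_left.2 fun j hj => ?_
    exact ((disjoint_lgAlloc_of_lgPrec (hprecs hj.2).2).mono_left Set.inter_subset_left).symm
  · have : Disjoint (lgAlloc S k) (shorterUnion S k) :=
      Set.disjoint_iUnion₂_right.2 fun j hj => disjoint_lgAlloc_of_lgPrec (hprecs hj.2).1
    rw [this.inter_eq, measure_empty]

end LengthGame

/-- All well behaved equilibria of the Length Game are Pareto efficient. -/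
theorem length_game_equilibrium_pareto_efficient {n : ℕ}
    (P : Fin n → Set ℝ) (hP : ∀ i, PWUniform (P i))
    (S : Fin n → Set ℝ) (hS : ∀ i, IsStrategy (S i))
    (hwb : ∀ i, S i ⊆ P i)
    (heq : lgEquilibrium P S) :
    ¬ ∃ B : Fin n → Set ℝ, (∀ i, MeasurableSet (B i)) ∧ (∀ i, B i ⊆ Set.Icc 0 1) ∧
      (∀ i j, i ≠ j → Disjoint (B i) (B j)) ∧
      (∀ i, pwUtil (P i) (lgAlloc S i) ≤ pwUtil (P i) (B i)) ∧
      (∃ j, pwUtil (P j) (lgAlloc S j) < pwUtil (P j) (B j)) := by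
  rintro ⟨B, hBm, -, hBd, hle, j, hj⟩
  simp only [pwUtil_lt_iff (hP _), pwUtil_le_iff (hP _)] at hle hj
  have hA (i : Fin n) : lgAlloc S i ∩ P i = lgAlloc S i :=
    Set.inter_eq_left.2 ((lgAlloc_subset i).trans (hwb i))
  have hlt : ∑ i, volume (lgAlloc S i ∩ P i) < ∑ i, volume (B i ∩ P i) := by
    rw [← Finset.add_sum_erase _ _ (Finset.mem_univ j),
      ← Finset.add_sum_erase (a := j) _ (fun i => volume (B i ∩ P i)) (Finset.mem_univ j)]
    refine ENNReal.add_lt_add_of_lt_of_le ?_ hj (Finset.sum_le_sum fun i _ => hle i)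
    exact ENNReal.sum_ne_top.2 fun i _ => (hP i).volume_inter_ne_top _
  refine hlt.not_ge ?_
  calc ∑ i, volume (B i ∩ P i) = volume (⋃ i, B i ∩ P i) := by
        rw [measure_iUnion (fun i k hik => (hBd i k hik).mono Set.inter_subset_left
          Set.inter_subset_left) fun i => (hBm i).inter (hP i).measurableSet, tsum_fintype]
    _ ≤ volume ((⋃ i, S i) ∪ ⋃ i, P i \ ⋃ k, S k) := by
        refine measure_mono (Set.iUnion_subset fun i x hx => ?_)
        by_cases h : x ∈ ⋃ k, S k
        · exact Or.inl h
        · exact Or.inr (Set.mem_iUnion.2 ⟨i, hx.2, h⟩)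
    _ ≤ volume (⋃ i, S i) + volume (⋃ i, P i \ ⋃ k, S k) := measure_union_le _ _
    _ = volume (⋃ i, S i) := by
        rw [measure_iUnion_null fun i => heq.volume_diff_iUnion_eq_zero hP hS hwb i, add_zero]
    _ ≤ volume (⋃ i, lgAlloc S i) := measure_mono iUnion_subset_iUnion_lgAlloc
    _ ≤ ∑ i, volume (lgAlloc S i) := measure_iUnion_fintype_le _ _
    _ = ∑ i, volume (lgAlloc S i ∩ P i) := by simp only [hA]
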